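/- arXiv:1004.4872 — 2 statements merged into one kernel-verified Lean document; each statement's English description precedes it below -/
import Mathlib

section
/- For every ε > 0 there exists x₀ such that for all real x ≥ x₀, S(x) ≥ (3/4 − ε) · x / log x. -/
/-- A Hadamard matrix of order `n`: an `n × n` real matrix with entries in `{-1, +1}`
satisfying `H * Hᵀ = n • I`. -/
def IsHadamardMatrix {n : ℕ} (H : Matrix (Fin n) (Fin n) ℝ) : Prop :=
  (∀ i j, H i j = 1 ∨ H i j = -1) ∧ H * H.transpose = (n : ℝ) • 1

/-- There exists a Hadamard matrix of order `n`. -/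
def HadamardOrder (n : ℕ) : Prop :=
  ∃ H : Matrix (Fin n) (Fin n) ℝ, IsHadamardMatrix H

/-- `S x` is the number of positive integers `n ≤ x` for which a Hadamard matrix
of order `n` exists. -/
noncomputable def S (x : ℝ) : ℕ :=
  {n : ℕ | 0 < n ∧ (n : ℝ) ≤ x ∧ HadamardOrder n}.ncard

open Matrix in
theorem hadamardOrder_card {ι : Type*} [Fintype ι] [DecidableEq ι] (A : Matrix ι ι ℝ)
    (hA : ∀ i j, A i j = 1 ∨ A i j = -1) (hmul : A * Aᵀ = (Fintype.card ι : ℝ) • 1) :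
    HadamardOrder (Fintype.card ι) := by
  let e := Fintype.equivFin ι
  refine ⟨A.submatrix e.symm e.symm, fun i j => hA _ _, ?_⟩
  rw [transpose_submatrix, submatrix_mul_equiv, hmul]
  ext i j
  simp [one_apply]

open Matrix Kronecker in
theorem HadamardOrder.mul {m n : ℕ} (hm : HadamardOrder m) (hn : HadamardOrder n) :
    HadamardOrder (m * n) := by
  obtain ⟨A, hA, hA'⟩ := hm
  obtain ⟨B, hB, hB'⟩ := hn
  have := hadamardOrder_card (A ⊗ₖ B) ?_ ?_
  · simpa using this
  · rintro ⟨i, i'⟩ ⟨j, j'⟩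
    rcases hA i j with h | h <;> rcases hB i' j' with h' | h' <;> simp [h, h']
  · rw [← kroneckerMap_transpose, ← mul_kronecker_mul, hA', hB', smul_kronecker, kronecker_smul,
      one_kronecker_one, smul_smul]
    simp

open Matrix in
/-- The Paley-type doubling: a conference matrix of order `n` yields a Hadamard matrix of
order `2 * n`. -/
theorem hadamardOrder_two_mul_card {ι : Type*} [Fintype ι] [DecidableEq ι] (C : Matrix ι ι ℝ)
    (hdiag : ∀ i, C i i = 0) (hoff : ∀ i j, i ≠ j → C i j = 1 ∨ C i j = -1) {r : ℝ} (hr : r ≠ 0)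
    (hcard : (Fintype.card ι : ℝ) = r + 1) (hC : C * Cᵀ = r • 1) :
    HadamardOrder (2 * Fintype.card ι) := by
  have hC' : Cᵀ * C = r • 1 := by
    have h1 : C * (r⁻¹ • Cᵀ) = 1 := by
      rw [mul_smul_comm, hC, smul_smul, inv_mul_cancel₀ hr, one_smul]
    have h2 := mul_eq_one_comm.mp h1
    rw [← smul_inv_smul₀ hr Cᵀ, smul_mul_assoc, h2]
  have := hadamardOrder_card (fromBlocks (C + 1) (C - 1) (Cᵀ - 1) (-(Cᵀ + 1))) ?_ ?_
  · simpa [two_mul] using this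
  · rintro (i | i) (j | j) <;> by_cases h : i = j
    all_goals first
      | (subst h; simp [hdiag])
      | (simp [h, hoff]; done)
      | simpa [h, neg_eq_iff_eq_neg, or_comm] using hoff j i (Ne.symm h)
  · rw [fromBlocks_transpose, fromBlocks_multiply, ← fromBlocks_one, fromBlocks_smul]
    simp only [transpose_add, transpose_sub, transpose_neg, transpose_one, transpose_transpose,
      smul_zero]
    have hs : ((Fintype.card (ι ⊕ ι) : ℕ) : ℝ) • (1 : Matrix ι ι ℝ) =
        r • (1 : Matrix ι ι ℝ) + r • (1 : Matrix ι ι ℝ) + 1 + 1 := by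
      rw [Fintype.card_sum, Nat.cast_add, hcard]
      module
    rw [hs]
    congr 1
    · nth_rw 1 [← hC]
      rw [← hC]
      noncomm_ring
    · noncomm_ring
    · noncomm_ring
    · nth_rw 1 [← hC']
      rw [← hC']
      noncomm_ring

theorem sum_quadraticChar_sub_mul_sub {F : Type*} [Field F] [Fintype F] [DecidableEq F]
    (hF : ringChar F ≠ 2) (a b : F) (hab : a ≠ b) :
    ∑ k, quadraticChar F (a - k) * quadraticChar F (b - k) = -1 := by
  have hd : a - b ≠ 0 := sub_ne_zero.mpr hab
  have hJ := jacobiSum_nontrivial_inv (quadraticChar_ne_one hF)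
  rw [(quadraticChar_isQuadratic F).inv, jacobiSum] at hJ
  let e : F ≃ F := (Equiv.mulLeft₀ (a - b) hd).trans (Equiv.subLeft a)
  rw [← e.sum_comp]
  have h1 : ∀ x, quadraticChar F (a - e x) * quadraticChar F (b - e x) =
      quadraticChar F (-1) * (quadraticChar F x * quadraticChar F (1 - x)) := by
    intro x
    have e1 : a - e x = (a - b) * x := by simp [e]
    have e2 : b - e x = (a - b) * (-1 * (1 - x)) := by simp [e]; ring
    rw [e1, e2]
    simp only [map_mul]
    linear_combination quadraticChar F x * quadraticChar F (-1) * quadraticChar F (1 - x) *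
      quadraticChar_sq_one hd
  rw [Finset.sum_congr rfl fun x _ => h1 x, ← Finset.mul_sum, hJ]
  linear_combination -quadraticChar_sq_one (F := F) (a := -1) (by simp)

open Matrix in
theorem hadamardOrder_two_mul_add_one {p : ℕ} (hp : p.Prime) (hp2 : p ≠ 2) :
    HadamardOrder (2 * (p + 1)) := by
  have := Fact.mk hp
  have hF : ringChar (ZMod p) ≠ 2 := by rwa [ZMod.ringChar_zmod_n]
  let χ := quadraticChar (ZMod p)
  obtain ⟨C, h00, h0s, hs0, hss⟩ : ∃ C : Matrix (Option (ZMod p)) (Option (ZMod p)) ℝ,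
      C none none = 0 ∧ (∀ b, C none (some b) = 1) ∧ (∀ a, C (some a) none = 1) ∧
        ∀ a b, C (some a) (some b) = χ (a - b) :=
    ⟨fun i j => i.elim (j.elim 0 fun _ => 1) fun a => j.elim 1 fun b => (χ (a - b) : ℝ),
      rfl, fun _ => rfl, fun _ => rfl, fun _ _ => rfl⟩
  have h0 : ∀ a, ∑ k, χ (a - k) = 0 := fun a =>
    ((Equiv.subLeft a).sum_comp χ).trans (quadraticChar_sum_zero hF)
  have := hadamardOrder_two_mul_card C ?_ ?_ (r := p) (by simp [hp.ne_zero]) (by simp) ?_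
  · simpa using this
  · rintro (_ | a) <;> simp [h00, hss, χ]
  · rintro (_ | a) (_ | b) h <;> simp [h0s, hs0, hss] at h ⊢
    rcases quadraticChar_dichotomy (sub_ne_zero.mpr h) with h | h <;> simp [χ, h]
  · ext i j
    rw [mul_apply, Fintype.sum_option]
    rcases i with _ | a <;> rcases j with _ | b
    · simp [h00, h0s]
    · simpa [h00, h0s, hs0, hss] using mod_cast h0 b
    · simpa [h00, h0s, hs0, hss] using mod_cast h0 a
    · simp only [transpose_apply, hs0, hss, mul_one]
      by_cases hab : a = b
      · subst hab
        have : ∀ k, χ (a - k) * χ (a - k) = if k = a then 0 else 1 := by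
          intro k
          split_ifs with h
          · simp [h, χ]
          · rw [← sq]; exact quadraticChar_sq_one (sub_ne_zero.mpr (Ne.symm h))
        have h2 : ∑ k, χ (a - k) * χ (a - k) = (p : ℤ) - 1 := by
          simp only [this, Finset.sum_ite, Finset.sum_const_zero, zero_add, Finset.sum_const]
          rw [Finset.filter_ne', Finset.card_erase_of_mem (Finset.mem_univ _)]
          simp [Nat.cast_sub hp.one_le]
        have h3 : ∑ k, (χ (a - k) : ℝ) * χ (a - k) = (p : ℝ) - 1 := by exact_mod_cast h2
        rw [h3]; simp
      · have h3 : ∑ k, (χ (a - k) : ℝ) * χ (b - k) = -1 := by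
          exact_mod_cast sum_quadraticChar_sub_mul_sub hF a b hab
        rw [h3]; simp [hab]

section

open Finset

theorem sum_range_mul_of_periodic {F G : ℕ → ℝ} {m n : ℕ} (hm : m ≠ 0) (hn : n ≠ 0)
    (hmn : m.Coprime n) (hF : Function.Periodic F m) (hG : Function.Periodic G n) :
    ∑ t ∈ range (m * n), F t * G t = (∑ t ∈ range m, F t) * ∑ t ∈ range n, G t := by
  rw [sum_mul_sum, ← sum_product']
  refine sum_bij (fun t _ => (t % m, t % n)) ?_ ?_ ?_ ?_
  · intro t _
    simp [Nat.mod_lt, Nat.pos_of_ne_zero, hm, hn]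
  · intro t ht u hu h
    rw [mem_range] at ht hu
    rw [Prod.mk.injEq] at h
    exact ((Nat.modEq_and_modEq_iff_modEq_mul hmn).mp h).eq_of_lt_of_lt ht hu
  · rintro ⟨a, b⟩ hab
    rw [mem_product, mem_range, mem_range] at hab
    refine ⟨Nat.chineseRemainder hmn a b, mem_range.mpr (Nat.chineseRemainder_lt_mul hmn a b hm hn),
      ?_⟩
    have h := (Nat.chineseRemainder hmn a b).2
    exact Prod.ext (Eq.trans h.1 (Nat.mod_eq_of_lt hab.1)) (Eq.trans h.2 (Nat.mod_eq_of_lt hab.2))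
  · intro t _
    rw [hF.map_mod_nat, hG.map_mod_nat]

theorem periodic_prod {f : ℕ → ℕ → ℝ} {s : Finset ℕ} (hf : ∀ l ∈ s, Function.Periodic (f l) l) :
    Function.Periodic (fun t => ∏ l ∈ s, f l t) (∏ l ∈ s, l) := by
  intro t
  refine prod_congr rfl fun l hl => ?_
  obtain ⟨k, hk⟩ := dvd_prod_of_mem (fun l => l) hl
  rw [hk, mul_comm]
  exact (hf l hl).nat_mul k t

theorem sum_range_prod_prod_of_periodic {f : ℕ → ℕ → ℝ} {s : Finset ℕ}
    (hs : ∀ l ∈ s, l.Prime) (hf : ∀ l ∈ s, Function.Periodic (f l) l) :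
    ∑ t ∈ range (∏ l ∈ s, l), ∏ l ∈ s, f l t = ∏ l ∈ s, ∑ t ∈ range l, f l t := by
  induction s using Finset.induction_on with
  | empty => simp
  | insert q s hq ih =>
    have hs' : ∀ l ∈ s, l.Prime := fun l hl => hs l (mem_insert_of_mem hl)
    have hf' : ∀ l ∈ s, Function.Periodic (f l) l := fun l hl => hf l (mem_insert_of_mem hl)
    have hqp := hs q (mem_insert_self q s)
    simp only [prod_insert hq]
    rw [sum_range_mul_of_periodic hqp.ne_zero (prod_ne_zero_iff.mpr fun l hl => (hs' l hl).ne_zero)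
      ?_ (hf q (mem_insert_self q s)) (periodic_prod hf'), ih hs' hf']
    exact Nat.Coprime.prod_right fun l hl => (Nat.coprime_primes hqp (hs' l hl)).mpr
      fun h => hq (h ▸ hl)

theorem sum_range_le_of_periodic {F : ℕ → ℝ} {m : ℕ} (hm : m ≠ 0) (hF : Function.Periodic F m)
    (hb : ∀ t, |F t| ≤ 1) (N : ℕ) :
    ∑ t ∈ range N, F t ≤ N * ((∑ t ∈ range m, F t) / m) + 2 * m := by
  have hm' : (0 : ℝ) < m := by positivity
  have hsum : ∀ k, ∑ t ∈ range (m * k), F t = k * ∑ t ∈ range m, F t := by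
    intro k
    induction k with
    | zero => simp
    | succ k ih =>
      rw [mul_add_one, sum_range_add, ih]
      have : ∀ t ∈ range m, F (m * k + t) = F t := fun t _ => by
        rw [add_comm, mul_comm]; exact hF.nat_mul k t
      rw [sum_congr rfl this]
      push_cast; ring
  have hA : |∑ t ∈ range m, F t| ≤ m :=
    (abs_sum_le_sum_abs _ _).trans ((sum_le_sum fun t _ => hb t).trans (by simp))
  have hr : ∑ t ∈ range (N % m), F (m * (N / m) + t) ≤ m := by
    refine (sum_le_sum fun t _ => (le_abs_self _).trans (hb _)).trans ?_
    simpa using (Nat.mod_lt N (Nat.pos_of_ne_zero hm)).le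
  have hN : (N : ℝ) = m * (N / m : ℕ) + (N % m : ℕ) := by exact_mod_cast (Nat.div_add_mod N m).symm
  have hmod : ((N % m : ℕ) : ℝ) ≤ m := by exact_mod_cast (Nat.mod_lt N (Nat.pos_of_ne_zero hm)).le
  have h2 : -(m : ℝ) ≤ (N % m : ℕ) * ((∑ t ∈ range m, F t) / m) := by
    rw [← mul_div_assoc, le_div_iff₀ hm']
    have : |((N % m : ℕ) : ℝ) * ∑ t ∈ range m, F t| ≤ m * m := by
      rw [abs_mul, abs_of_nonneg (Nat.cast_nonneg _)]
      gcongr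
    linarith [neg_abs_le (((N % m : ℕ) : ℝ) * ∑ t ∈ range m, F t)]
  rw [← Nat.div_add_mod N m, sum_range_add, hsum, Nat.div_add_mod, hN, add_mul]
  have h3 : (m * (N / m : ℕ) : ℝ) * ((∑ t ∈ range m, F t) / m) =
      (N / m : ℕ) * ∑ t ∈ range m, F t := by
    field_simp
  linarith

theorem sum_range_prod_mul_prod_le {g : ℕ → ℕ → ℝ} {h : ℕ → ℝ} {d e : Finset ℕ} {z : ℕ}
    (hprime : ∀ l ∈ d ∪ e, l.Prime) (hper : ∀ l ∈ d ∪ e, Function.Periodic (g l) l)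
    (hmean : ∀ l ∈ d ∪ e, ∑ t ∈ range l, g l t = 0)
    (hsq : ∀ l ∈ d ∪ e, ∑ t ∈ range l, g l t ^ 2 = l * h l)
    (hb : ∀ l ∈ d ∪ e, ∀ t, |g l t| ≤ 1) (hd : ∏ l ∈ d, l ≤ z) (he : ∏ l ∈ e, l ≤ z) (N : ℕ) :
    ∑ t ∈ range N, (∏ l ∈ d, g l t) * ∏ l ∈ e, g l t ≤
      (if d = e then N * ∏ l ∈ d, h l else 0) + 2 * z ^ 2 := by
  let f : ℕ → ℕ → ℝ := fun l t => (if l ∈ d then g l t else 1) * (if l ∈ e then g l t else 1)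
  have hfe : ∀ t, (∏ l ∈ d, g l t) * ∏ l ∈ e, g l t = ∏ l ∈ d ∪ e, f l t := by
    intro t
    rw [prod_mul_distrib, prod_ite_mem, prod_ite_mem, union_inter_cancel_left,
      union_inter_cancel_right]
  have hfper : ∀ l ∈ d ∪ e, Function.Periodic (f l) l := by
    intro l hl t
    simp only [f, hper l hl t]
  have hfb : ∀ t, |∏ l ∈ d ∪ e, f l t| ≤ 1 := by
    intro t
    rw [abs_prod]
    refine prod_le_one (fun _ _ => abs_nonneg _) fun l hl => ?_
    rw [abs_mul]
    refine mul_le_one₀ ?_ (abs_nonneg _) ?_ <;> split_ifs <;> simp [hb l hl t]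
  have hm : ∏ l ∈ d ∪ e, l ≠ 0 := prod_ne_zero_iff.mpr fun l hl => (hprime l hl).ne_zero
  have hmz : ∏ l ∈ d ∪ e, l ≤ z ^ 2 := by
    have h1 : (∏ l ∈ d ∪ e, l) * ∏ l ∈ d ∩ e, l = (∏ l ∈ d, l) * ∏ l ∈ e, l :=
      prod_union_inter
    have h2 : 1 ≤ ∏ l ∈ d ∩ e, l := one_le_prod' fun l hl =>
      (hprime l (inter_subset_union hl)).one_le
    calc ∏ l ∈ d ∪ e, l ≤ (∏ l ∈ d ∪ e, l) * ∏ l ∈ d ∩ e, l := Nat.le_mul_of_pos_right _ h2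
      _ ≤ z ^ 2 := by rw [h1, sq]; gcongr
  simp only [hfe]
  refine (sum_range_le_of_periodic hm (periodic_prod hfper) hfb N).trans ?_
  rw [sum_range_prod_prod_of_periodic hprime hfper]
  have hmz' : ((∏ l ∈ d ∪ e, l : ℕ) : ℝ) ≤ z ^ 2 := by exact_mod_cast hmz
  refine add_le_add ?_ (by gcongr)
  split_ifs with hde
  · subst hde
    rw [union_self] at *
    have : ∏ l ∈ d, ∑ t ∈ range l, f l t = (∏ l ∈ d, l : ℕ) * ∏ l ∈ d, h l := by
      rw [Nat.cast_prod, ← prod_mul_distrib]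
      refine prod_congr rfl fun l hl => ?_
      simp [f, hl, ← sq, hsq l hl]
    rw [this, mul_div_cancel_left₀ _ (by exact_mod_cast hm)]
  · obtain ⟨l, hl, hl'⟩ : ∃ l ∈ d ∪ e, ∑ t ∈ range l, f l t = 0 := by
      have hne : ¬ ∀ l, l ∈ d ↔ l ∈ e := fun H => hde (Finset.ext H)
      push Not at hne
      obtain ⟨l, ⟨h1, h2⟩ | ⟨h1, h2⟩⟩ := hne
      · have hl : l ∈ d ∪ e := mem_union_left _ h1
        exact ⟨l, hl, by simp [f, h1, h2, hmean l hl]⟩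
      · have hl : l ∈ d ∪ e := mem_union_right _ h2
        exact ⟨l, hl, by simp [f, h1, h2, hmean l hl]⟩
    rw [prod_eq_zero hl hl']
    simp

/-- A large sieve type upper bound: `g l` plays the role of a normalized mean-zero function modulo
`l`, which takes the constant value `h l` on the sifted set `A`. -/
theorem card_mul_sq_le_of_sifted {P : Finset ℕ} {g : ℕ → ℕ → ℝ} {h : ℕ → ℝ}
    (hprime : ∀ l ∈ P, l.Prime) (hper : ∀ l ∈ P, Function.Periodic (g l) l)
    (hmean : ∀ l ∈ P, ∑ t ∈ range l, g l t = 0)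
    (hsq : ∀ l ∈ P, ∑ t ∈ range l, g l t ^ 2 = l * h l)
    (hb : ∀ l ∈ P, ∀ t, |g l t| ≤ 1) {z N : ℕ} {D : Finset (Finset ℕ)}
    (hD : ∀ d ∈ D, d ⊆ P ∧ ∏ l ∈ d, l ≤ z) {A : Finset ℕ} (hA : A ⊆ range N)
    (hAg : ∀ t ∈ A, ∀ l ∈ P, g l t = h l) :
    #A * (∑ d ∈ D, ∏ l ∈ d, h l) ^ 2 ≤ N * (∑ d ∈ D, ∏ l ∈ d, h l) + 2 * z ^ 4 := by
  have hcard : #D ≤ z := by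
    rw [← Nat.add_sub_cancel (n := z) (m := 1), ← Nat.card_Icc]
    refine card_le_card_of_injOn (fun d => ∏ l ∈ d, l) (fun d hd => ?_) fun d hd e he hde => ?_
    · exact mem_coe.mpr (mem_Icc.mpr ⟨one_le_prod' fun l hl => (hprime l ((hD d hd).1 hl)).one_le,
        (hD d hd).2⟩)
    · have hp : ∀ d ∈ D, (∏ l ∈ d, l).primeFactors = d := fun d hd =>
        Nat.primeFactors_prod fun l hl => hprime l ((hD d hd).1 hl)
      rw [← hp d hd, ← hp e he]
      exact congrArg Nat.primeFactors hde
  calc (#A : ℝ) * (∑ d ∈ D, ∏ l ∈ d, h l) ^ 2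
      = ∑ t ∈ A, (∑ d ∈ D, ∏ l ∈ d, g l t) ^ 2 := by
        have : ∀ t ∈ A, (∑ d ∈ D, ∏ l ∈ d, g l t) ^ 2 = (∑ d ∈ D, ∏ l ∈ d, h l) ^ 2 :=
          fun t ht => congrArg (· ^ 2) <| sum_congr rfl fun d hd => prod_congr rfl fun l hl =>
            hAg t ht l ((hD d hd).1 hl)
        rw [sum_congr rfl this, sum_const, nsmul_eq_mul]
    _ ≤ ∑ t ∈ range N, (∑ d ∈ D, ∏ l ∈ d, g l t) ^ 2 :=
        sum_le_sum_of_subset_of_nonneg hA fun _ _ _ => sq_nonneg _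
    _ = ∑ d ∈ D, ∑ e ∈ D, ∑ t ∈ range N, (∏ l ∈ d, g l t) * ∏ l ∈ e, g l t := by
        simp only [sq, sum_mul_sum]
        rw [sum_comm]
        exact sum_congr rfl fun d _ => sum_comm
    _ ≤ ∑ d ∈ D, ∑ e ∈ D, ((if d = e then N * ∏ l ∈ d, h l else 0) + 2 * (z : ℝ) ^ 2) := by
        refine sum_le_sum fun d hd => sum_le_sum fun e he => ?_
        have hsub : d ∪ e ⊆ P := union_subset (hD d hd).1 (hD e he).1
        exact sum_range_prod_mul_prod_le (fun l hl => hprime l (hsub hl))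
          (fun l hl => hper l (hsub hl)) (fun l hl => hmean l (hsub hl))
          (fun l hl => hsq l (hsub hl)) (fun l hl => hb l (hsub hl)) (hD d hd).2 (hD e he).2 N
    _ = N * (∑ d ∈ D, ∏ l ∈ d, h l) + #D ^ 2 * (2 * (z : ℝ) ^ 2) := by
        simp only [sum_add_distrib, sum_ite_eq, sum_const, nsmul_eq_mul]
        rw [sum_congr rfl fun d hd => if_pos hd, mul_sum]
        ring
    _ ≤ N * (∑ d ∈ D, ∏ l ∈ d, h l) + (z : ℝ) ^ 2 * (2 * (z : ℝ) ^ 2) := by gcongr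
    _ = _ := by ring

theorem sum_le_sum_of_injOn_map {α β : Type*} [DecidableEq β] {s : Finset α} {t : Finset β}
    {f : α → ℝ} {g : β → ℝ} (e : α → β) (hmaps : ∀ a ∈ s, e a ∈ t) (hinj : Set.InjOn e s)
    (hle : ∀ a ∈ s, f a ≤ g (e a)) (hg : ∀ b ∈ t, 0 ≤ g b) :
    ∑ a ∈ s, f a ≤ ∑ b ∈ t, g b :=
  calc ∑ a ∈ s, f a ≤ ∑ a ∈ s, g (e a) := sum_le_sum hle
    _ = ∑ b ∈ s.image e, g b := (sum_image hinj).symm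
    _ ≤ ∑ b ∈ t, g b := sum_le_sum_of_subset_of_nonneg (image_subset_iff.mpr hmaps)
        fun b hb _ => hg b hb

theorem one_add_sum_le_prod_one_add {α : Type*} (s : Finset α) {f : α → ℝ}
    (hf : ∀ a ∈ s, 0 ≤ f a) : 1 + ∑ a ∈ s, f a ≤ ∏ a ∈ s, (1 + f a) := by
  classical
  induction s using Finset.induction_on with
  | empty => simp
  | insert a s ha ih =>
    have hs : ∀ a ∈ s, 0 ≤ f a := fun b hb => hf b (mem_insert_of_mem hb)
    rw [sum_insert ha, prod_insert ha]
    nlinarith [ih hs, hf a (mem_insert_self a s), sum_nonneg hs]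

/-- The finite sets of primes greater than `y` with product at most `z`, which stand for the
squarefree `y`-rough numbers up to `z`. -/
def roughPrimeSets (y z : ℕ) : Finset (Finset ℕ) :=
  ((Ioc y z).filter Nat.Prime).powerset.filter fun s => ∏ l ∈ s, l ≤ z

theorem mem_roughPrimeSets {y z : ℕ} {s : Finset ℕ} :
    s ∈ roughPrimeSets y z ↔ (∀ l ∈ s, l.Prime ∧ y < l) ∧ ∏ l ∈ s, l ≤ z := by
  simp only [roughPrimeSets, mem_filter, mem_powerset, subset_iff, mem_Ioc]
  refine ⟨fun h => ⟨fun l hl => ⟨(h.1 hl).2, (h.1 hl).1.1⟩, h.2⟩,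
    fun h => ⟨fun l hl => ⟨⟨(h.1 l hl).2, ?_⟩, (h.1 l hl).1⟩, h.2⟩⟩
  exact (Nat.le_of_dvd (prod_pos fun l hl => (h.1 l hl).1.pos)
    (dvd_prod_of_mem (fun l => l) hl)).trans h.2

theorem log_le_two_mul_sum_roughPrimeSets {z : ℕ} (hz : z ≠ 0) :
    Real.log z ≤ 2 * ∑ s ∈ roughPrimeSets 0 z, ∏ l ∈ s, (1 / l : ℝ) := by
  have h1 : Real.log z ≤ ∑ n ∈ Icc 1 z, (1 / n : ℝ) := by
    have := log_add_one_le_harmonic z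
    rw [harmonic_eq_sum_Icc] at this
    push_cast at this
    simp only [one_div]
    refine le_trans (Real.log_le_log (by positivity) ?_) this
    linarith
  have h2 : ∑ m ∈ Ioo 0 (z + 1), ((m : ℝ) ^ 2)⁻¹ ≤ 2 := by
    simpa using sum_Ioo_inv_sq_le (α := ℝ) 0 (z + 1)
  have hnn : ∀ s : Finset ℕ, 0 ≤ ∏ l ∈ s, (1 / l : ℝ) :=
    fun s => prod_nonneg fun _ _ => by positivity
  choose a b hab ha using Nat.sq_mul_squarefree
  refine h1.trans ?_
  calc ∑ n ∈ Icc 1 z, (1 / n : ℝ)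
      ≤ ∑ x ∈ Ioo 0 (z + 1) ×ˢ roughPrimeSets 0 z,
          ((x.1 : ℝ) ^ 2)⁻¹ * ∏ l ∈ x.2, (1 / l : ℝ) := by
        refine sum_le_sum_of_injOn_map (fun n => (b n, (a n).primeFactors)) ?_ ?_ ?_
          fun x _ => mul_nonneg (by positivity) (hnn _)
        · intro n hn
          rw [mem_Icc] at hn
          have hn0 : b n ^ 2 * a n ≠ 0 := by rw [hab]; lia
          have hb0 : b n ≠ 0 := fun h => hn0 (by simp [h])
          have ha0 : a n ≠ 0 := (ha n).ne_zero
          rw [mem_product, mem_Ioo, mem_roughPrimeSets]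
          refine ⟨⟨Nat.pos_of_ne_zero hb0, ?_⟩, fun l hl => ?_, ?_⟩
          · have : b n ≤ b n ^ 2 * a n :=
              (Nat.le_self_pow two_ne_zero _).trans (Nat.le_mul_of_pos_right _ (by lia))
            have := hab n
            simp only
            lia
          · have := Nat.prime_of_mem_primeFactors hl
            exact ⟨this, this.pos⟩
          · rw [Nat.prod_primeFactors_of_squarefree (ha n)]
            have : a n ≤ b n ^ 2 * a n := Nat.le_mul_of_pos_left _ (by positivity)
            have := hab n
            lia
        · intro n _ m _ hnm
          simp only [Prod.mk.injEq] at hnm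
          rw [← hab n, ← hab m, hnm.1, ← Nat.prod_primeFactors_of_squarefree (ha n), hnm.2,
            Nat.prod_primeFactors_of_squarefree (ha m)]
        · intro n _
          have : ((n : ℕ) : ℝ) = (b n : ℝ) ^ 2 * ∏ l ∈ (a n).primeFactors, (l : ℝ) := by
            rw [← Nat.cast_prod, Nat.prod_primeFactors_of_squarefree (ha n)]
            exact_mod_cast (hab n).symm
          rw [this]
          simp [mul_comm]
    _ = (∑ m ∈ Ioo 0 (z + 1), ((m : ℝ) ^ 2)⁻¹) *
          ∑ s ∈ roughPrimeSets 0 z, ∏ l ∈ s, (1 / l : ℝ) := by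
        rw [sum_mul_sum, sum_product]
    _ ≤ _ := by
        gcongr

theorem sum_roughPrimeSets_zero_le (w z : ℕ) :
    ∑ s ∈ roughPrimeSets 0 z, ∏ l ∈ s, (1 / l : ℝ) ≤
      (∏ l ∈ (Ioc 0 w).filter Nat.Prime, (1 + 1 / l : ℝ)) *
        ∑ s ∈ roughPrimeSets w z, ∏ l ∈ s, (1 / l : ℝ) := by
  have hnn : ∀ s : Finset ℕ, 0 ≤ ∏ l ∈ s, (1 / l : ℝ) :=
    fun s => prod_nonneg fun _ _ => by positivity
  rw [prod_one_add, sum_mul_sum, ← sum_product']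
  refine sum_le_sum_of_injOn_map (fun s => (s.filter (· ≤ w), s.filter (¬ · ≤ w))) ?_ ?_ ?_
    fun x _ => mul_nonneg (hnn _) (hnn _)
  · intro s hs
    rw [mem_roughPrimeSets] at hs
    rw [mem_product, mem_powerset, mem_roughPrimeSets]
    refine ⟨fun l hl => ?_, fun l hl => ?_, ?_⟩
    · rw [mem_filter] at hl
      rw [mem_filter, mem_Ioc]
      exact ⟨⟨(hs.1 l hl.1).2, hl.2⟩, (hs.1 l hl.1).1⟩
    · rw [mem_filter] at hl
      exact ⟨(hs.1 l hl.1).1, not_le.mp hl.2⟩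
    · exact (prod_le_prod_of_subset_of_one_le' (filter_subset _ _)
        fun l hl _ => (hs.1 l hl).1.one_le).trans hs.2
  · intro s _ t _ hst
    simp only [Prod.mk.injEq] at hst
    rw [← filter_union_filter_not_eq (· ≤ w) s, hst.1, hst.2, filter_union_filter_not_eq]
  · intro s _
    exact (prod_filter_mul_prod_filter_not s (· ≤ w) fun l => (1 / l : ℝ)).ge

theorem prod_one_add_mul_sum_roughPrimeSets_le {h : ℕ → ℝ} {y w : ℕ} (hyw : y ≤ w)
    (hh : ∀ l, y < l → 1 / l ≤ h l) (z : ℕ) :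
    (∏ l ∈ (Ioc y w).filter Nat.Prime, (1 + h l)) *
        ∑ s ∈ roughPrimeSets w z, ∏ l ∈ s, (1 / l : ℝ) ≤
      ∑ s ∈ roughPrimeSets y ((∏ l ∈ (Ioc y w).filter Nat.Prime, l) * z), ∏ l ∈ s, h l := by
  have hh0 : ∀ l, y < l → 0 ≤ h l := fun l hl => le_trans (by positivity) (hh l hl)
  rw [prod_one_add, sum_mul_sum, ← sum_product']
  have key : ∀ x ∈ ((Ioc y w).filter Nat.Prime).powerset ×ˢ roughPrimeSets w z,
      (∀ l ∈ x.1, (y < l ∧ l ≤ w) ∧ l.Prime) ∧ (∀ l ∈ x.2, l.Prime ∧ w < l) ∧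
        ∏ l ∈ x.2, l ≤ z := by
    intro x hx
    rw [mem_product, mem_powerset, mem_roughPrimeSets] at hx
    exact ⟨fun l hl => by simpa using hx.1 hl, hx.2⟩
  have hdisj : ∀ x ∈ ((Ioc y w).filter Nat.Prime).powerset ×ˢ roughPrimeSets w z,
      Disjoint x.1 x.2 := by
    intro x hx
    rw [disjoint_left]
    intro l hl hl'
    have h1 := ((key x hx).1 l hl).1.2
    have h2 := ((key x hx).2.1 l hl').2
    lia
  refine sum_le_sum_of_injOn_map (fun x => x.1 ∪ x.2) ?_ ?_ ?_ ?_
  · intro x hx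
    obtain ⟨h1, h2, h3⟩ := key x hx
    rw [mem_roughPrimeSets, prod_union (hdisj x hx)]
    refine ⟨fun l hl => ?_, Nat.mul_le_mul ?_ h3⟩
    · rcases mem_union.mp hl with hl | hl
      · exact ⟨(h1 l hl).2, (h1 l hl).1.1⟩
      · exact ⟨(h2 l hl).1, hyw.trans_lt (h2 l hl).2⟩
    · refine prod_le_prod_of_subset_of_one_le' (mem_powerset.mp (mem_product.mp hx).1)
        fun l hl _ => (mem_filter.mp hl).2.one_le
  · have hrec : ∀ x ∈ ((Ioc y w).filter Nat.Prime).powerset ×ˢ roughPrimeSets w z,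
        (x.1 ∪ x.2).filter (· ≤ w) = x.1 ∧ (x.1 ∪ x.2).filter (¬ · ≤ w) = x.2 := by
      intro x hx
      obtain ⟨h1, h2, -⟩ := key x hx
      constructor <;> ext l <;> simp only [mem_filter, mem_union] <;> constructor
      · rintro ⟨hl | hl, hw⟩
        · exact hl
        · exact absurd (h2 l hl).2 (not_lt.mpr hw)
      · exact fun hl => ⟨Or.inl hl, (h1 l hl).1.2⟩
      · rintro ⟨hl | hl, hw⟩
        · exact absurd (h1 l hl).1.2 hw
        · exact hl
      · exact fun hl => ⟨Or.inr hl, not_le.mpr (h2 l hl).2⟩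
    intro x hx x' hx' hxx
    simp only at hxx
    exact Prod.ext
      ((hrec x hx).1.symm.trans (by rw [hxx]; exact (hrec x' hx').1))
      ((hrec x hx).2.symm.trans (by rw [hxx]; exact (hrec x' hx').2))
  · intro x hx
    obtain ⟨h1, h2, -⟩ := key x hx
    simp only [prod_union (hdisj x hx)]
    refine mul_le_mul_of_nonneg_left (prod_le_prod (fun _ _ => by positivity) fun l hl =>
      hh l (hyw.trans_lt (h2 l hl).2)) (prod_nonneg fun l hl => hh0 l (h1 l hl).1.1)
  · intro s hs
    exact prod_nonneg fun l hl => hh0 l ((mem_roughPrimeSets.mp hs).1 l hl).2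

theorem exists_le_sum_primes_one_div (y : ℕ) (K : ℝ) :
    ∃ w, y ≤ w ∧ K ≤ ∑ l ∈ (Ioc y w).filter Nat.Prime, (1 / l : ℝ) := by
  have step : ∀ v, ∃ w, v ≤ w ∧ 1 / 2 ≤ ∑ l ∈ (Ioc v w).filter Nat.Prime, (1 / l : ℝ) := by
    intro v
    refine ⟨max v (4 ^ ((v + 1).primesBelow.card + 1)), le_max_left _ _,
      (one_half_le_sum_primes_ge_one_div (v + 1)).trans ?_⟩
    refine sum_le_sum_of_subset_of_nonneg (fun l hl => ?_) fun _ _ _ => by positivity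
    simp only [mem_sdiff, Nat.mem_primesBelow] at hl
    simp only [mem_filter, mem_Ioc, le_max_iff]
    have := hl.2
    have := hl.1
    grind
  have all : ∀ n : ℕ, ∃ w, y ≤ w ∧ (n / 2 : ℝ) ≤ ∑ l ∈ (Ioc y w).filter Nat.Prime, (1 / l : ℝ) := by
    intro n
    induction n with
    | zero => exact ⟨y, le_rfl, by simp⟩
    | succ n ih =>
      obtain ⟨v, hv, hv'⟩ := ih
      obtain ⟨w, hw, hw'⟩ := step v
      refine ⟨w, hv.trans hw, ?_⟩
      rw [← Ioc_union_Ioc_eq_Ioc hv hw, filter_union, sum_union]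
      · push_cast; linarith
      · exact disjoint_filter_filter (Ioc_disjoint_Ioc_of_le le_rfl)
  obtain ⟨n, hn⟩ := exists_nat_ge (2 * K)
  obtain ⟨w, hw, hw'⟩ := all n
  exact ⟨w, hw, by linarith⟩

theorem exists_mul_log_le_sum_roughPrimeSets (y : ℕ) (K : ℝ) :
    ∃ W : ℕ, W ≠ 0 ∧ ∀ h : ℕ → ℝ, (∀ l, y < l → 2 / l ≤ h l) → ∀ z : ℕ, z ≠ 0 →
      K * Real.log z ≤ ∑ s ∈ roughPrimeSets y (W * z), ∏ l ∈ s, h l := by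
  let B : ℝ := ∏ l ∈ (Ioc 0 y).filter Nat.Prime, (1 + 1 / l : ℝ)
  have hB : 0 < B := prod_pos fun l _ => by positivity
  obtain ⟨w, hyw, hw⟩ := exists_le_sum_primes_one_div y (4 * B * max K 0)
  refine ⟨∏ l ∈ (Ioc y w).filter Nat.Prime, l,
    prod_ne_zero_iff.mpr fun l hl => (mem_filter.mp hl).2.ne_zero, fun h hh z hz => ?_⟩
  refine le_trans ?_ (prod_one_add_mul_sum_roughPrimeSets_le hyw (fun l hl =>
    le_trans (by gcongr; norm_num) (hh l hl)) z)
  set R := ∑ s ∈ roughPrimeSets w z, ∏ l ∈ s, (1 / l : ℝ)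
  have hR0 : 0 ≤ R := sum_nonneg fun s _ => prod_nonneg fun _ _ => by positivity
  have h1 := log_le_two_mul_sum_roughPrimeSets hz
  have h2 := sum_roughPrimeSets_zero_le w z
  set Q := ∏ l ∈ (Ioc y w).filter Nat.Prime, (1 + 1 / l : ℝ)
  have hQ : ∏ l ∈ (Ioc 0 w).filter Nat.Prime, (1 + 1 / l : ℝ) = B * Q := by
    rw [← Ioc_union_Ioc_eq_Ioc (Nat.zero_le y) hyw, filter_union, prod_union]
    exact disjoint_filter_filter (Ioc_disjoint_Ioc_of_le le_rfl)
  have hQ0 : 0 ≤ Q := prod_nonneg fun l _ => by positivity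
  have h3 : 2 * B * max K 0 * Q ≤ ∏ l ∈ (Ioc y w).filter Nat.Prime, (1 + h l) := by
    have h4 : 2 * B * max K 0 ≤ ∏ l ∈ (Ioc y w).filter Nat.Prime, (1 + (1 / (l + 1) : ℝ)) := by
      refine le_trans ?_ (one_add_sum_le_prod_one_add _ fun l _ => by positivity)
      have : (1 / 2 : ℝ) * ∑ l ∈ (Ioc y w).filter Nat.Prime, (1 / l : ℝ) ≤
          ∑ l ∈ (Ioc y w).filter Nat.Prime, (1 / (l + 1) : ℝ) := by
        rw [mul_sum]
        refine sum_le_sum fun l hl => ?_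
        have hl1 : (1 : ℝ) ≤ l := by exact_mod_cast (mem_filter.mp hl).2.one_le
        rw [one_div_mul_one_div, one_div_le_one_div (by positivity) (by positivity)]
        linarith
      linarith
    calc 2 * B * max K 0 * Q
        ≤ (∏ l ∈ (Ioc y w).filter Nat.Prime, (1 + (1 / (l + 1) : ℝ))) * Q := by gcongr
      _ = ∏ l ∈ (Ioc y w).filter Nat.Prime, (1 + 2 / l : ℝ) := by
        rw [← prod_mul_distrib]
        refine prod_congr rfl fun l hl => ?_
        have hl1 : (0 : ℝ) < l := by exact_mod_cast (mem_filter.mp hl).2.pos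
        field_simp
        ring
      _ ≤ _ := by
        refine prod_le_prod (fun _ _ => by positivity) fun l hl => ?_
        have := hh l (mem_Ioc.mp (mem_filter.mp hl).1).1
        linarith
  have hK : 0 ≤ max K 0 := le_max_right _ _
  have hlog : 0 ≤ Real.log z := Real.log_natCast_nonneg z
  calc K * Real.log z ≤ max K 0 * Real.log z := by gcongr; exact le_max_left _ _
    _ ≤ max K 0 * (2 * (B * Q * R)) := by
      gcongr
      rw [hQ] at h2
      linarith
    _ = (2 * B * max K 0 * Q) * R := by ring
    _ ≤ _ := by gcongr

theorem card_filter_range_eq_two {a b l : ℕ} [Fact l.Prime] (ha : 0 < a) (hal : a < l) (hbl : b < l)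
    (hab : a ≠ b) :
    #(filter (fun t : ℕ => (t : ZMod l) = 1 ∨ (a * t : ZMod l) = b) (range l)) = 2 := by
  have ha0 : (a : ZMod l) ≠ 0 := by
    rw [Ne, ZMod.natCast_eq_zero_iff]
    exact Nat.not_dvd_of_pos_of_lt ha hal
  have h1 : (1 : ZMod l) ≠ (a : ZMod l)⁻¹ * b := by
    intro h
    rw [eq_inv_mul_iff_mul_eq₀ ha0, mul_one, ZMod.natCast_eq_natCast_iff] at h
    exact hab (h.eq_of_lt_of_lt hal hbl)
  have : ((filter (fun t : ℕ => (t : ZMod l) = 1 ∨ (a * t : ZMod l) = b) (range l)) : Finset ℕ) =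
      {ZMod.val (1 : ZMod l), ZMod.val ((a : ZMod l)⁻¹ * (b : ZMod l))} := by
    ext t
    simp only [mem_filter, mem_range, mem_insert, mem_singleton]
    have hval : ∀ u : ZMod l, t = u.val ↔ t < l ∧ (t : ZMod l) = u := fun u =>
      ⟨by rintro rfl; exact ⟨u.val_lt, ZMod.natCast_rightInverse u⟩,
        fun h => by rw [← h.2, ZMod.val_natCast_of_lt h.1]⟩
    rw [hval, hval, ← and_or_left, eq_inv_mul_iff_mul_eq₀ ha0]
  rw [this, card_pair fun h => h1 (ZMod.val_injective l h)]

theorem card_sifted_mul_sq_le {a b y : ℕ} (ha : 0 < a) (hay : a ≤ y) (hby : b ≤ y) (hy : 4 ≤ y)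
    (hab : a ≠ b) (z : ℕ) {N : ℕ} {A : Finset ℕ} (hA : A ⊆ range N)
    (hAs : ∀ t ∈ A, ∀ l, l.Prime → y < l → l ≤ z → ¬ ((t : ZMod l) = 1 ∨ (a * t : ZMod l) = b)) :
    #A * (∑ d ∈ roughPrimeSets y z, ∏ l ∈ d, (2 / (l - 2) : ℝ)) ^ 2 ≤
      N * (∑ d ∈ roughPrimeSets y z, ∏ l ∈ d, (2 / (l - 2) : ℝ)) + 2 * z ^ 4 := by
  classical
  let g : ℕ → ℕ → ℝ := fun l t =>
    if (t : ZMod l) = 1 ∨ (a * t : ZMod l) = b then -1 else 2 / (l - 2)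
  have hP : ∀ l ∈ (Ioc y z).filter Nat.Prime, l.Prime ∧ y < l ∧ l ≤ z := fun l hl => by
    rw [mem_filter, mem_Ioc] at hl
    exact ⟨hl.2, hl.1⟩
  have hl4 : ∀ l ∈ (Ioc y z).filter Nat.Prime, (4 : ℝ) < l := fun l hl => by
    exact_mod_cast hy.trans_lt (hP l hl).2.1
  have hsum : ∀ l ∈ (Ioc y z).filter Nat.Prime, ∀ u v : ℝ, ∑ t ∈ range l,
      (if (t : ZMod l) = 1 ∨ (a * t : ZMod l) = b then u else v) = 2 * u + (l - 2) * v := by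
    intro l hl u v
    obtain ⟨h1, h2, -⟩ := hP l hl
    have := Fact.mk h1
    have hcard := card_filter_range_eq_two ha (hay.trans_lt h2) (hby.trans_lt h2) hab
    have hcard' := card_filter_add_card_filter_not (s := range l)
      fun t : ℕ => (t : ZMod l) = 1 ∨ (a * t : ZMod l) = b
    rw [hcard, card_range] at hcard'
    rw [sum_ite, sum_const, sum_const, hcard, nsmul_eq_mul, nsmul_eq_mul]
    have : ((2 + #(filter (fun t : ℕ => ¬ ((t : ZMod l) = 1 ∨ (a * t : ZMod l) = b)) (range l)) :
        ℕ) : ℝ) = l := by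
      rw [hcard']
    push_cast at this ⊢
    rw [← this]
    ring
  refine card_mul_sq_le_of_sifted (P := (Ioc y z).filter Nat.Prime) (g := g)
    (fun l hl => (hP l hl).1) ?_ ?_ ?_ ?_ ?_ hA ?_
  · intro l _ t
    simp [g]
  · intro l hl
    have := hl4 l hl
    rw [hsum l hl, mul_div_cancel₀ _ (by linarith)]
    norm_num
  · intro l hl
    have := hl4 l hl
    have h2 : (l : ℝ) - 2 ≠ 0 := by linarith
    simp only [g, ite_pow]
    rw [hsum l hl]
    field_simp
    ring
  · intro l hl t
    have := hl4 l hl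
    simp only [g]
    split_ifs
    · simp
    · rw [abs_of_nonneg (div_nonneg zero_le_two (by linarith)), div_le_one (by linarith)]
      linarith
  · intro d hd
    rw [mem_roughPrimeSets] at hd
    refine ⟨fun l hl => ?_, hd.2⟩
    rw [mem_filter, mem_Ioc]
    refine ⟨⟨(hd.1 l hl).2, ?_⟩, (hd.1 l hl).1⟩
    exact (Nat.le_of_dvd (prod_pos fun l hl => (hd.1 l hl).1.pos)
      (dvd_prod_of_mem (fun l => l) hl)).trans hd.2
  · intro t ht l hl
    obtain ⟨h1, h2, h3⟩ := hP l hl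
    exact if_neg (hAs t ht l h1 h2 h3)

/-- The `s < N` such that `s - 1` and `a * s / b - 1` are both primes. -/
noncomputable def shiftedPrimePairs (a b N : ℕ) : Finset ℕ :=
  open Classical in
  {s ∈ range N | ∃ p p' : ℕ, p.Prime ∧ p'.Prime ∧ s = p + 1 ∧ a * s = b * (p' + 1)}

theorem card_shiftedPrimePairs_le {a b y : ℕ} (ha : 0 < a) (hb : 0 < b) (hay : a ≤ y) (hby : b ≤ y)
    (hy : 4 ≤ y) (hab : a ≠ b) (z N : ℕ) {G : ℝ} (hG : 1 ≤ G)
    (hG' : G ≤ ∑ d ∈ roughPrimeSets y z, ∏ l ∈ d, (2 / (l - 2) : ℝ)) :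
    (#(shiftedPrimePairs a b N) : ℝ) ≤ N / G + 2 * z ^ 4 + (b * (z + 1) + 1) := by
  classical
  set A : Finset ℕ := {t ∈ range N | ∀ l, l.Prime → y < l → l ≤ z →
    ¬ ((t : ZMod l) = 1 ∨ (a * t : ZMod l) = b)} with hA
  have hsub : shiftedPrimePairs a b N ⊆ A ∪ range (b * (z + 1) + 1) := by
    intro s hs
    rw [shiftedPrimePairs, mem_filter] at hs
    obtain ⟨hsN, p, p', hp, hp', hsp, hsp'⟩ := hs
    rw [mem_union, or_iff_not_imp_left, hA, mem_filter, not_and]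
    intro h
    have h := h hsN
    push Not at h
    obtain ⟨l, hl, hyl, hlz, h⟩ := h
    have := Fact.mk hl
    rw [mem_range, Nat.lt_succ_iff]
    rcases h with h | h
    · have : l = p := by
        rw [hsp, Nat.cast_add, Nat.cast_one, add_eq_right, ZMod.natCast_eq_zero_iff] at h
        exact (Nat.prime_dvd_prime_iff_eq hl hp).mp h
      calc s ≤ 1 * (z + 1) := by lia
        _ ≤ _ := Nat.mul_le_mul_right _ hb
    · have : l = p' := by
        have hb0 : (b : ZMod l) ≠ 0 := by
          rw [Ne, ZMod.natCast_eq_zero_iff]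
          exact Nat.not_dvd_of_pos_of_lt hb (hby.trans_lt hyl)
        rw [← Nat.cast_mul, hsp', Nat.cast_mul, Nat.cast_add, Nat.cast_one, mul_add, mul_one,
          add_eq_right, mul_eq_zero, or_iff_right hb0, ZMod.natCast_eq_zero_iff] at h
        exact (Nat.prime_dvd_prime_iff_eq hl hp').mp h
      calc s ≤ a * s := Nat.le_mul_of_pos_left _ ha
        _ = b * (p' + 1) := hsp'
        _ ≤ _ := Nat.mul_le_mul_left _ (by lia)
  have hcard : #(shiftedPrimePairs a b N) ≤ #A + (b * (z + 1) + 1) :=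
    (card_le_card hsub).trans ((card_union_le _ _).trans (by rw [card_range]))
  have hcard' : (#(shiftedPrimePairs a b N) : ℝ) ≤ #A + (b * (z + 1) + 1) := by exact_mod_cast hcard
  refine hcard'.trans (add_le_add_left ?_ _)
  have hsieve := card_sifted_mul_sq_le ha hay hby hy hab z (filter_subset _ _ : A ⊆ range N)
    fun t ht => (mem_filter.mp ht).2
  set H := ∑ d ∈ roughPrimeSets y z, ∏ l ∈ d, (2 / (l - 2) : ℝ)
  have hH : 0 < H := by linarith
  calc (#A : ℝ) = #A * H ^ 2 / H ^ 2 := by field_simp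
    _ ≤ (N * H + 2 * z ^ 4) / H ^ 2 := by gcongr
    _ = N / H + 2 * z ^ 4 / H ^ 2 := by field_simp
    _ ≤ N / G + 2 * z ^ 4 := by
      gcongr
      exact div_le_self (by positivity) (one_le_pow₀ (hG.trans hG'))

open Filter in
theorem eventually_card_shiftedPrimePairs_le {a b : ℕ} (ha : 0 < a) (hb : 0 < b) (hab : a ≠ b)
    {δ : ℝ} (hδ : 0 < δ) :
    ∀ᶠ x : ℝ in atTop, (#(shiftedPrimePairs a b (⌊x⌋₊ + 1)) : ℝ) ≤ δ * (x / Real.log x) := by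
  obtain ⟨W, -, hW⟩ := exists_mul_log_le_sum_roughPrimeSets (a + b + 4) (64 / δ)
  have hh : ∀ l : ℕ, a + b + 4 < l → (2 / l : ℝ) ≤ 2 / (l - 2) := by
    intro l hl
    have : ((a + b + 4 : ℕ) : ℝ) < l := by exact_mod_cast hl
    push_cast at this
    have ha' : (0 : ℝ) ≤ a := by positivity
    have hb' : (0 : ℝ) ≤ b := by positivity
    exact div_le_div_of_nonneg_left zero_le_two (by linarith) (by linarith)
  set C : ℝ := 2 * W ^ 4 + (b * (W + 1) + 1)
  have hC : 0 < C := by positivity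
  have hlog := (isLittleO_log_rpow_atTop (show (0 : ℝ) < 1 / 2 by norm_num)).bound
    (show 0 < δ / (2 * C) by positivity)
  have hlarge : ∀ᶠ x : ℝ in atTop, 1 ≤ 4 / δ * Real.log x :=
    (Real.tendsto_log_atTop.const_mul_atTop (show 0 < 4 / δ by positivity)).eventually_ge_atTop 1
  filter_upwards [hlog, hlarge, eventually_ge_atTop (2 ^ 16 : ℝ)] with x hx1 hx2 hx3
  have hx0 : 0 < x := by linarith
  have hL : 0 < Real.log x := Real.log_pos (by linarith)
  set u : ℝ := x ^ (1 / 16 : ℝ)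
  have hu : 2 ≤ u := by
    have : (2 : ℝ) = (2 ^ 16 : ℝ) ^ (1 / 16 : ℝ) := by
      rw [← Real.rpow_natCast, ← Real.rpow_mul (by norm_num)]
      norm_num
    rw [this]
    exact Real.rpow_le_rpow (by norm_num) hx3 (by norm_num)
  have hu16 : u ^ 16 = x := by
    rw [← Real.rpow_natCast, ← Real.rpow_mul hx0.le]
    norm_num
  have hu8 : x ^ (1 / 2 : ℝ) = u ^ 8 := by
    rw [← Real.rpow_natCast, ← Real.rpow_mul hx0.le]
    norm_num
  have hlogu : Real.log u = Real.log x / 16 := by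
    rw [Real.log_rpow hx0]
    ring
  set z : ℕ := ⌊u ^ 2⌋₊
  have hz1 : (z : ℝ) ≤ u ^ 2 := Nat.floor_le (by positivity)
  have hz2 : u ≤ z := by
    have := Nat.lt_floor_add_one (u ^ 2)
    nlinarith
  have hz0 : z ≠ 0 := by
    rintro h
    rw [h, Nat.cast_zero] at hz2
    linarith
  have hG : 4 / δ * Real.log x ≤
      ∑ d ∈ roughPrimeSets (a + b + 4) (W * z), ∏ l ∈ d, (2 / (l - 2) : ℝ) := by
    refine le_trans ?_ (hW (fun l => 2 / (l - 2)) hh z hz0)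
    have : Real.log x / 16 ≤ Real.log z := hlogu ▸ Real.log_le_log (by linarith) hz2
    calc 4 / δ * Real.log x = 64 / δ * (Real.log x / 16) := by ring
      _ ≤ _ := by gcongr
  refine (card_shiftedPrimePairs_le ha hb (by lia) (by lia) (by lia) hab (W * z) (⌊x⌋₊ + 1) hx2
    hG).trans ?_
  have hN : ((⌊x⌋₊ + 1 : ℕ) : ℝ) ≤ 2 * x := by
    push_cast
    linarith [Nat.floor_le hx0.le]
  have h1 : ((⌊x⌋₊ + 1 : ℕ) : ℝ) / (4 / δ * Real.log x) ≤ δ / 2 * (x / Real.log x) :=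
    calc _ ≤ 2 * x / (4 / δ * Real.log x) := by gcongr
      _ = _ := by field_simp; norm_num
  have hu1 : 1 ≤ u ^ 8 := one_le_pow₀ (by linarith)
  have hu2 : u ^ 2 ≤ u ^ 8 := pow_le_pow_right₀ (by linarith) (by norm_num)
  have h2 : 2 * ((W * z : ℕ) : ℝ) ^ 4 + (b * ((W * z : ℕ) + 1) + 1) ≤ C * u ^ 8 := by
    push_cast
    calc 2 * ((W : ℝ) * z) ^ 4 + (b * (W * z + 1) + 1)
        ≤ 2 * ((W : ℝ) * u ^ 2) ^ 4 + (b * (W * u ^ 8 + u ^ 8) + u ^ 8) := by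
          gcongr
          exact hz1.trans hu2
      _ = _ := by ring
  have h3 : C * u ^ 8 ≤ δ / 2 * (x / Real.log x) := by
    rw [Real.norm_of_nonneg hL.le, Real.norm_of_nonneg (by positivity), hu8] at hx1
    rw [← mul_div_assoc, le_div_iff₀ hL]
    calc C * u ^ 8 * Real.log x ≤ C * u ^ 8 * (δ / (2 * C) * u ^ 8) := by gcongr
      _ = δ / 2 * u ^ 16 := by field_simp
      _ = _ := by rw [hu16]
  linarith

theorem sum_card_le_card_biUnion_add {ι α : Type*} [DecidableEq α] (s : Finset ι)
    (f : ι → Finset α) {B : ℝ} (hB : 0 ≤ B)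
    (hf : ∀ i ∈ s, ∀ j ∈ s, i ≠ j → (#(f i ∩ f j) : ℝ) ≤ B) :
    ∑ i ∈ s, (#(f i) : ℝ) ≤ #(s.biUnion f) + #s ^ 2 * B := by
  classical
  induction s using Finset.induction_on with
  | empty => simp
  | insert i s hi ih =>
    have ih := ih fun j hj k hk => hf j (mem_insert_of_mem hj) k (mem_insert_of_mem hk)
    have hinter : (#(f i ∩ s.biUnion f) : ℝ) ≤ #s * B := by
      rw [inter_biUnion]
      calc (#(s.biUnion fun j => f i ∩ f j) : ℝ) ≤ ∑ j ∈ s, (#(f i ∩ f j) : ℝ) := by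
            exact_mod_cast card_biUnion_le
        _ ≤ ∑ _j ∈ s, B := sum_le_sum fun j hj => hf i (mem_insert_self i s) j
            (mem_insert_of_mem hj) fun h => hi (h ▸ hj)
        _ = _ := by rw [sum_const, nsmul_eq_mul]
    have hunion : (#(f i ∪ s.biUnion f) : ℝ) + #(f i ∩ s.biUnion f) = #(f i) + #(s.biUnion f) := by
      exact_mod_cast card_union_add_card_inter (f i) (s.biUnion f)
    rw [sum_insert hi, biUnion_insert, card_insert_of_notMem hi]
    push_cast
    nlinarith [mul_nonneg (Nat.cast_nonneg (α := ℝ) #s) hB]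

/-- The numbers `4 (q + 1) (p + 1) ≤ x` with `p` an odd prime. -/
noncomputable def primeOrders (q : ℕ) (x : ℝ) : Finset ℕ :=
  open Classical in
  {n ∈ range (⌊x⌋₊ + 1) | ∃ p : ℕ, p.Prime ∧ p ≠ 2 ∧ n = 4 * (q + 1) * (p + 1)}

theorem card_primeOrders_inter_le (q q' : ℕ) (x : ℝ) :
    #(primeOrders q x ∩ primeOrders q' x) ≤
      #(shiftedPrimePairs (q + 1) (q' + 1) (⌊x⌋₊ + 1)) := by
  refine card_le_card_of_injOn (fun n => n / (4 * (q + 1))) ?_ ?_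
  · intro n hn
    simp only [primeOrders, coe_inter, Set.mem_inter_iff, mem_coe, mem_filter, mem_range] at hn
    obtain ⟨⟨hnx, p, hp, -, h⟩, -, p', hp', -, h'⟩ := hn
    have hdiv : n / (4 * (q + 1)) = p + 1 := by rw [h, Nat.mul_div_cancel_left _ (by positivity)]
    simp only [shiftedPrimePairs, mem_coe, mem_filter, mem_range]
    refine ⟨(Nat.div_le_self _ _).trans_lt hnx, p, p', hp, hp', hdiv, ?_⟩
    rw [hdiv]
    lia
  · intro n hn m hm h
    simp only [primeOrders, coe_inter, Set.mem_inter_iff, mem_coe, mem_filter, mem_range] at hn hm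
    obtain ⟨⟨-, p, -, -, hp⟩, -⟩ := hn
    obtain ⟨⟨-, p', -, -, hp'⟩, -⟩ := hm
    simp only [hp, hp', Nat.mul_div_cancel_left _ (show 0 < 4 * (q + 1) by positivity)] at h
    rw [hp, hp', h]

open Filter in
theorem eventually_half_mul_le_primeCounting :
    ∀ᶠ u : ℝ in atTop, u / 2 ≤ (Nat.primeCounting ⌊u⌋₊ - 1) * Real.log u := by
  have h := (Real.isLittleO_log_id_atTop).bound (show (0 : ℝ) < 1 / 100 by norm_num)
  filter_upwards [h, eventually_ge_atTop 100] with u hu hu2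
  have hL : 0 < Real.log u := Real.log_pos (by linarith)
  rw [Real.norm_of_nonneg hL.le, id, Real.norm_of_nonneg (by linarith)] at hu
  have h1 := Chebyshev.pi_ge' (show 1 < u by linarith)
  rw [div_le_iff₀ hL] at h1
  have h2 : Real.log (u + 2) ≤ Real.log u + 1 := by
    have : Real.log (u + 2) ≤ Real.log (2 * u) := Real.log_le_log (by linarith) (by linarith)
    rw [Real.log_mul two_ne_zero (by linarith)] at this
    linarith [Real.log_two_lt_d9]
  have h3 : (u - 1) * 0.69 ≤ (u - 1) * Real.log 2 := by
    have := Real.log_two_gt_d9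
    gcongr <;> linarith
  norm_num at h3
  linarith

open Filter in
theorem eventually_le_card_primeOrders (q : ℕ) :
    ∀ᶠ x : ℝ in atTop, 1 / (16 * (q + 1)) * (x / Real.log x) ≤ #(primeOrders q x) := by
  have hc : (0 : ℝ) < 4 * (q + 1) := by positivity
  have htend : Tendsto (fun x : ℝ => x / (4 * (q + 1)) - 1) atTop atTop :=
    tendsto_atTop_add_const_right _ (-1) (tendsto_id.atTop_div_const hc)
  filter_upwards [htend.eventually eventually_half_mul_le_primeCounting,
    htend.eventually_ge_atTop 1, eventually_gt_atTop 1] with x hx hx1 hx2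
  set u : ℝ := x / (4 * (q + 1)) - 1 with hu
  have hux : x = (u + 1) * (4 * (q + 1)) := by rw [hu]; field_simp; ring
  have hq : (0 : ℝ) ≤ q := by positivity
  have hL : 0 < Real.log x := Real.log_pos hx2
  have hcard : (Nat.primeCounting ⌊u⌋₊ : ℝ) - 1 ≤ #(primeOrders q x) := by
    rw [sub_le_iff_le_add]
    have : Nat.primeCounting ⌊u⌋₊ - 1 ≤ #(primeOrders q x) := by
      rw [Nat.primeCounting, ← Nat.primesBelow_card_eq_primeCounting']
      refine pred_card_le_card_erase.trans (card_le_card_of_injOn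
        (s := (Nat.primesBelow (⌊u⌋₊ + 1)).erase 2)
        (fun p => 4 * (q + 1) * (p + 1)) ?_ ?_)
      · intro p hp
        simp only [coe_erase, Set.mem_sdiff, mem_coe, Nat.mem_primesBelow,
          Set.mem_singleton_iff] at hp
        simp only [primeOrders, mem_coe, mem_filter, mem_range, Nat.lt_succ_iff]
        refine ⟨Nat.le_floor ?_, p, hp.1.2, hp.2, rfl⟩
        have : (p : ℝ) ≤ u := (Nat.le_floor_iff (by linarith)).mp (Nat.lt_succ_iff.mp hp.1.1)
        push_cast
        rw [hux, mul_comm (4 * ((q : ℝ) + 1))]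
        gcongr
      · intro p _ p' _ h
        have := Nat.eq_of_mul_eq_mul_left (show 0 < 4 * (q + 1) by positivity) h
        lia
    exact_mod_cast (tsub_le_iff_right.mp this)
  refine le_trans ?_ hcard
  have hpos : 0 ≤ (Nat.primeCounting ⌊u⌋₊ - 1 : ℝ) := by
    by_contra! h
    have := mul_nonpos_of_nonpos_of_nonneg h.le (Real.log_nonneg hx1)
    linarith
  rw [← mul_div_assoc, div_le_iff₀ hL]
  have hle : u ≤ x := by nlinarith
  calc 1 / (16 * (q + 1)) * x = (u + 1) / 4 := by rw [hux]; field_simp; norm_num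
    _ ≤ u / 2 := by linarith
    _ ≤ _ := hx
    _ ≤ _ := by gcongr

theorem card_biUnion_primeOrders_le_S {Q : Finset ℕ} (hQ : ∀ q ∈ Q, q.Prime ∧ q ≠ 2) (x : ℝ) :
    #(Q.biUnion fun q => primeOrders q x) ≤ S x := by
  have hfin : {n : ℕ | 0 < n ∧ (n : ℝ) ≤ x ∧ HadamardOrder n}.Finite :=
    (Set.finite_Iic ⌊x⌋₊).subset fun n hn => Nat.le_floor hn.2.1
  rw [S, ← Set.ncard_coe_finset]
  refine Set.ncard_le_ncard ?_ hfin
  intro n hn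
  simp only [coe_biUnion, Set.mem_iUnion, mem_coe, primeOrders, mem_filter, mem_range,
    Nat.lt_succ_iff] at hn
  obtain ⟨q, hq, hnx, p, hp, hp2, rfl⟩ := hn
  refine ⟨by positivity, (Nat.le_floor_iff' (by positivity)).mp hnx, ?_⟩
  have := (hadamardOrder_two_mul_add_one (hQ q hq).1 (hQ q hq).2).mul
    (hadamardOrder_two_mul_add_one hp hp2)
  convert this using 1
  ring

open Filter in
theorem eventually_div_log_le_S : ∀ᶠ x : ℝ in atTop, x / Real.log x ≤ S x := by
  obtain ⟨w, -, hw⟩ := exists_le_sum_primes_one_div 2 64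
  set Q := (Ioc 2 w).filter Nat.Prime with hQdef
  have hQ : ∀ q ∈ Q, q.Prime ∧ q ≠ 2 := by
    intro q hq
    rw [hQdef, mem_filter, mem_Ioc] at hq
    exact ⟨hq.2, by lia⟩
  have hδ : (0 : ℝ) < 1 / (#Q ^ 2 + 1) := by positivity
  have hlow : ∀ᶠ x : ℝ in atTop, ∀ q ∈ Q,
      1 / (16 * (q + 1)) * (x / Real.log x) ≤ #(primeOrders q x) :=
    (eventually_all_finset Q).mpr fun q _ => eventually_le_card_primeOrders q
  have hup : ∀ᶠ x : ℝ in atTop, ∀ q ∈ Q, ∀ q' ∈ Q, q ≠ q' →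
      (#(primeOrders q x ∩ primeOrders q' x) : ℝ) ≤ 1 / (#Q ^ 2 + 1) * (x / Real.log x) := by
    refine (eventually_all_finset Q).mpr fun q _ => (eventually_all_finset Q).mpr fun q' _ => ?_
    by_cases h : q = q'
    · simp [h]
    · filter_upwards [eventually_card_shiftedPrimePairs_le q.succ_pos q'.succ_pos
        (Nat.succ_injective.ne h) hδ] with x hx _
      exact le_trans (by exact_mod_cast card_primeOrders_inter_le q q' x) hx
  filter_upwards [hlow, hup, eventually_gt_atTop 1] with x hx1 hx2 hx
  have hy : 0 ≤ x / Real.log x := div_nonneg (by linarith) (Real.log_nonneg hx.le)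
  set y := x / Real.log x
  have h1 : 2 * y ≤ ∑ q ∈ Q, (#(primeOrders q x) : ℝ) :=
    calc 2 * y = (1 / 32 * 64) * y := by ring
      _ ≤ (1 / 32 * ∑ q ∈ Q, (1 / q : ℝ)) * y := by gcongr
      _ = ∑ q ∈ Q, (1 / (32 * q) : ℝ) * y := by
        rw [mul_sum, sum_mul]
        refine sum_congr rfl fun q _ => ?_
        rw [one_div_mul_one_div]
      _ ≤ ∑ q ∈ Q, (1 / (16 * (q + 1)) : ℝ) * y := by
        refine sum_le_sum fun q hq => ?_
        have : (1 : ℝ) ≤ q := by exact_mod_cast (hQ q hq).1.one_le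
        gcongr ?_ * y
        exact one_div_le_one_div_of_le (by positivity) (by linarith)
      _ ≤ _ := sum_le_sum hx1
  have h2 := sum_card_le_card_biUnion_add Q (fun q => primeOrders q x)
    (mul_nonneg hδ.le hy) hx2
  have h3 : (#Q : ℝ) ^ 2 * (1 / (#Q ^ 2 + 1) * y) ≤ y := by
    rw [← mul_assoc, mul_one_div]
    exact mul_le_of_le_one_left hy ((div_le_one (by positivity)).mpr (by linarith))
  have h4 : (#(Q.biUnion fun q => primeOrders q x) : ℝ) ≤ S x := by
    exact_mod_cast card_biUnion_primeOrders_le_S hQ x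
  linarith

end

theorem hadamard_count_paley_lower :
    ∀ ε : ℝ, ε > 0 → ∃ x₀ : ℝ, ∀ x : ℝ, x ≥ x₀ →
      (S x : ℝ) ≥ (3 / 4 - ε) * x / Real.log x := by
  intro ε hε
  obtain ⟨x₀, hx₀⟩ := Filter.eventually_atTop.mp eventually_div_log_le_S
  refine ⟨max x₀ 1, fun x hx => ?_⟩
  have hx1 : 1 ≤ x := (le_max_right _ _).trans hx
  have hy : 0 ≤ x / Real.log x := div_nonneg (by linarith) (Real.log_nonneg hx1)
  refine ge_trans (hx₀ x ((le_max_left _ _).trans hx)) ?_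
  rw [mul_div_assoc]
  exact mul_le_of_le_one_left hy (by linarith)
end

section
/- Let k ≥ 1 and let a₁, …, a_k be positive integers such that a Hadamard matrix of order 4aᵢ exists for each i. Then there exists a Hadamard matrix of order 2^(2k − 4⌊(k−1)/3⌋ − ((k−1) mod 3)) · a₁a₂⋯a_k. (Equivalently, the naive Kronecker-product order 4^k·a₁⋯a_k can be divided by 2 raised to the power 4⌊(k−1)/3⌋ + ((k−1) mod 3).) -/
open scoped Kronecker in
/-- The matrix `((A + B) ⊗ C + (A - B) ⊗ D) / 2`. -/
noncomputable def kroneckerMix {m n p q : Type*} (A B : Matrix m n ℝ) (C D : Matrix p q ℝ) :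
    Matrix (m × p) (n × q) ℝ :=
  (1 / 2 : ℝ) • ((A + B) ⊗ₖ C + (A - B) ⊗ₖ D)

theorem kroneckerMix_entries {m n p q : Type*} {A B : Matrix m n ℝ} {C D : Matrix p q ℝ}
    (hA : ∀ i j, A i j = 1 ∨ A i j = -1) (hB : ∀ i j, B i j = 1 ∨ B i j = -1)
    (hC : ∀ i j, C i j = 1 ∨ C i j = -1) (hD : ∀ i j, D i j = 1 ∨ D i j = -1) :
    ∀ i j, kroneckerMix A B C D i j = 1 ∨ kroneckerMix A B C D i j = -1 := by
  rintro ⟨i, i'⟩ ⟨j, j'⟩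
  simp only [kroneckerMix, Matrix.smul_apply, Matrix.add_apply, Matrix.sub_apply,
    Matrix.kroneckerMap_apply, smul_eq_mul]
  rcases hA i j with h₁ | h₁ <;> rcases hB i j with h₂ | h₂ <;>
    rcases hC i' j' with h₃ | h₃ <;> rcases hD i' j' with h₄ | h₄ <;>
    rw [h₁, h₂, h₃, h₄] <;> norm_num

open scoped Kronecker in
theorem kroneckerMix_mul_transpose {m n p q : Type*} [Fintype n] [Fintype q]
    (A B A' B' : Matrix m n ℝ) (C D C' D' : Matrix p q ℝ) :
    kroneckerMix A B C D * (kroneckerMix A' B' C' D').transpose =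
      (1 / 4 : ℝ) • (((A + B) * (A' + B').transpose) ⊗ₖ (C * C'.transpose) +
        ((A + B) * (A' - B').transpose) ⊗ₖ (C * D'.transpose) +
        ((A - B) * (A' + B').transpose) ⊗ₖ (D * C'.transpose) +
        ((A - B) * (A' - B').transpose) ⊗ₖ (D * D'.transpose)) := by
  simp only [Matrix.mul_kronecker_mul, kroneckerMix, Matrix.transpose_smul,
    Matrix.transpose_add, ← Matrix.kroneckerMap_transpose, Matrix.smul_mul, Matrix.mul_smul,
    Matrix.add_mul (_ ⊗ₖ _), Matrix.mul_add _ (_ ⊗ₖ _)]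
  module

theorem hadamardOrder_of_matrix {m n : Type*} [Fintype m] [Fintype n] [DecidableEq m] {N : ℕ}
    (hm : Fintype.card m = N) (hn : Fintype.card n = N) (H : Matrix m n ℝ)
    (hH : ∀ i j, H i j = 1 ∨ H i j = -1) (hmul : H * H.transpose = (N : ℝ) • 1) :
    HadamardOrder N := by
  let e := (Fintype.equivFinOfCardEq hm).symm
  let f := (Fintype.equivFinOfCardEq hn).symm
  refine ⟨H.submatrix e f, fun i j => hH _ _, ?_⟩
  rw [Matrix.transpose_submatrix, Matrix.submatrix_mul_equiv, hmul]
  exact congrArg (fun A : Matrix (Fin N) (Fin N) ℝ => (N : ℝ) • A)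
    (Matrix.submatrix_one_equiv e)

/-- A pair `S`, `P` of `±1` matrices of order `N` with `S * Pᵀ = 0` and
`S * Sᵀ + P * Pᵀ = 2N • 1`. -/
structure IsOrthogonalPair {m n : Type*} [Fintype n] [DecidableEq m] (N : ℕ)
    (S P : Matrix m n ℝ) : Prop where
  left_entries : ∀ i j, S i j = 1 ∨ S i j = -1
  right_entries : ∀ i j, P i j = 1 ∨ P i j = -1
  mul_transpose : S * P.transpose = 0
  add_mul_transpose : S * S.transpose + P * P.transpose = (2 * N : ℝ) • 1

theorem IsOrthogonalPair.mul_transpose' {m n : Type*} [Fintype n] [DecidableEq m] {N : ℕ}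
    {S P : Matrix m n ℝ} (h : IsOrthogonalPair N S P) : P * S.transpose = 0 := by
  simpa using congrArg Matrix.transpose h.mul_transpose

/-- Craigen's orthogonal pair of order `4ab` built from Hadamard matrices of orders `4a`, `4b`. -/
theorem exists_isOrthogonalPair {a b : ℕ} (ha : HadamardOrder (4 * a))
    (hb : HadamardOrder (4 * b)) :
    ∃ S P : Matrix (Fin (4 * a) × Fin b) (Fin a × Fin (4 * b)) ℝ,
      IsOrthogonalPair (4 * a * b) S P := by
  obtain ⟨H, hH, hHH⟩ := ha
  obtain ⟨K, hK, hKK⟩ := hb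
  let A : Fin 4 → Matrix (Fin (4 * a)) (Fin a) ℝ :=
    fun i => H.submatrix id fun j => finProdFinEquiv (i, j)
  let B : Fin 4 → Matrix (Fin b) (Fin (4 * b)) ℝ :=
    fun i => K.submatrix (fun j => finProdFinEquiv (i, j)) id
  have hA : ∀ i r c, A i r c = 1 ∨ A i r c = -1 := fun _ _ _ => hH _ _
  have hB : ∀ i r c, B i r c = 1 ∨ B i r c = -1 := fun _ _ _ => hK _ _
  have hAA : A 0 * (A 0).transpose + A 1 * (A 1).transpose + A 2 * (A 2).transpose +
      A 3 * (A 3).transpose = ((4 * a : ℕ) : ℝ) • 1 := by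
    rw [← hHH]
    ext r s
    simp only [Matrix.add_apply, Matrix.mul_apply, Matrix.transpose_apply]
    rw [← finProdFinEquiv.sum_comp, Fintype.sum_prod_type, Fin.sum_univ_four]
    rfl
  have hBB : ∀ i, B i * (B i).transpose = (4 * b : ℝ) • 1 := by
    intro i
    ext r s
    have := congrFun₂ hKK (finProdFinEquiv (i, r)) (finProdFinEquiv (i, s))
    simpa [Matrix.mul_apply, B, Matrix.one_apply] using this
  have hBB' : ∀ i j, i ≠ j → B i * (B j).transpose = 0 := by
    intro i j hij
    ext r s
    have := congrFun₂ hKK (finProdFinEquiv (i, r)) (finProdFinEquiv (j, s))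
    simpa [Matrix.mul_apply, B, Matrix.one_apply, hij] using this
  refine ⟨kroneckerMix (A 0) (A 1) (B 0) (B 1), kroneckerMix (A 2) (A 3) (B 2) (B 3),
    kroneckerMix_entries (hA _) (hA _) (hB _) (hB _),
    kroneckerMix_entries (hA _) (hA _) (hB _) (hB _), ?_, ?_⟩
  · rw [kroneckerMix_mul_transpose, hBB' 0 2 (by decide), hBB' 0 3 (by decide),
      hBB' 1 2 (by decide), hBB' 1 3 (by decide)]
    simp
  · rw [kroneckerMix_mul_transpose, kroneckerMix_mul_transpose, hBB' 0 1 (by decide),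
      hBB' 1 0 (by decide), hBB' 2 3 (by decide), hBB' 3 2 (by decide), hBB, hBB, hBB, hBB]
    have key : (A 0 + A 1) * (A 0 + A 1).transpose + (A 0 - A 1) * (A 0 - A 1).transpose +
        ((A 2 + A 3) * (A 2 + A 3).transpose + (A 2 - A 3) * (A 2 - A 3).transpose) =
        (2 : ℝ) • ((4 * a : ℕ) : ℝ) • 1 := by
      rw [← hAA]
      simp only [Matrix.transpose_add, Matrix.transpose_sub, Matrix.add_mul, Matrix.mul_add,
        Matrix.sub_mul, Matrix.mul_sub, two_smul]
      abel
    simp only [Matrix.kroneckerMap_zero_right _ mul_zero, add_zero, ← smul_add,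
      ← Matrix.add_kronecker, key, Matrix.kronecker_smul, Matrix.smul_kronecker,
      Matrix.one_kronecker_one, smul_smul]
    congr 1
    push_cast
    ring

theorem IsOrthogonalPair.hadamardOrder_two_mul {m n : Type*} [Fintype m] [Fintype n]
    [DecidableEq m] {N : ℕ} (hm : Fintype.card m = N) (hn : Fintype.card n = N)
    {S P : Matrix m n ℝ} (h : IsOrthogonalPair N S P) : HadamardOrder (2 * N) := by
  refine hadamardOrder_of_matrix (m := m ⊕ m) (n := n ⊕ n) (by simp [hm, two_mul])
    (by simp [hn, two_mul]) (Matrix.fromBlocks S P P S) ?_ ?_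
  · rintro (i | i) (j | j)
    exacts [h.left_entries i j, h.right_entries i j, h.right_entries i j, h.left_entries i j]
  · rw [Matrix.fromBlocks_transpose, Matrix.fromBlocks_multiply, h.mul_transpose,
      h.mul_transpose', add_comm (P * _), h.add_mul_transpose, ← Matrix.fromBlocks_one,
      Matrix.fromBlocks_smul]
    simp

open scoped Kronecker in
theorem IsOrthogonalPair.hadamardOrder_mul {m n p q : Type*} [Fintype m] [Fintype n]
    [Fintype p] [Fintype q] [DecidableEq m] [DecidableEq p] {M N : ℕ}
    (hm : Fintype.card m = M) (hn : Fintype.card n = M)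
    (hp : Fintype.card p = N) (hq : Fintype.card q = N)
    {S P : Matrix m n ℝ} {T Q : Matrix p q ℝ}
    (h : IsOrthogonalPair M S P) (h' : IsOrthogonalPair N T Q) : HadamardOrder (M * N) := by
  refine hadamardOrder_of_matrix (m := m × p) (n := n × q) (by simp [hm, hp])
    (by simp [hn, hq]) (kroneckerMix S P T Q)
    (kroneckerMix_entries h.left_entries h.right_entries h'.left_entries h'.right_entries) ?_
  have h₁ : (S + P) * (S + P).transpose = (2 * M : ℝ) • 1 := by
    simp [Matrix.mul_add, Matrix.add_mul, h.mul_transpose, h.mul_transpose',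
      ← h.add_mul_transpose]
  have h₂ : (S - P) * (S - P).transpose = (2 * M : ℝ) • 1 := by
    simp [Matrix.mul_sub, Matrix.sub_mul, h.mul_transpose, h.mul_transpose',
      ← h.add_mul_transpose]
  rw [kroneckerMix_mul_transpose, h'.mul_transpose, h'.mul_transpose', h₁, h₂]
  simp only [Matrix.kroneckerMap_zero_right _ mul_zero, add_zero]
  rw [← Matrix.kronecker_add, h'.add_mul_transpose]
  simp only [Matrix.kronecker_smul, Matrix.smul_kronecker,
    Matrix.one_kronecker_one, smul_smul]
  congr 1
  push_cast
  ring

theorem HadamardOrder.product_two {a b : ℕ} (ha : HadamardOrder (4 * a))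
    (hb : HadamardOrder (4 * b)) : HadamardOrder (8 * a * b) := by
  obtain ⟨S, P, h⟩ := exists_isOrthogonalPair ha hb
  convert h.hadamardOrder_two_mul (by simp) (by simp; ring) using 1
  ring

theorem HadamardOrder.product_four {a b c d : ℕ} (ha : HadamardOrder (4 * a))
    (hb : HadamardOrder (4 * b)) (hc : HadamardOrder (4 * c)) (hd : HadamardOrder (4 * d)) :
    HadamardOrder (16 * a * b * c * d) := by
  obtain ⟨S, P, h⟩ := exists_isOrthogonalPair ha hb
  obtain ⟨T, Q, h'⟩ := exists_isOrthogonalPair hc hd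
  convert h.hadamardOrder_mul (by simp) (by simp; ring) (by simp) (by simp; ring) h' using 1
  ring

theorem hadamard_product_powers_of_two_saving (k : ℕ) (hk : 1 ≤ k)
    (a : Fin k → ℕ) (ha : ∀ i, 0 < a i)
    (hH : ∀ i, HadamardOrder (4 * a i)) :
    HadamardOrder (2 ^ (2 * k - 4 * ((k - 1) / 3) - (k - 1) % 3) * ∏ i, a i) := by
  induction k using Nat.strong_induction_on with
  | _ k ih =>
  match k, hk with
  | 1, _ => simpa using hH 0
  | 2, _ =>
    convert (hH 0).product_two (hH 1) using 1
    simp [Fin.prod_univ_two, mul_assoc]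
  | 3, _ =>
    have h : HadamardOrder (4 * (2 * a 0 * a 1)) := by
      convert (hH 0).product_two (hH 1) using 1
      ring
    convert h.product_two (hH 2) using 1
    simp [Fin.prod_univ_three]
    ring
  | k + 4, _ =>
    have h := ih (k + 1) (by omega) (by omega) (fun i => a i.castSucc.castSucc.castSucc)
      (fun _ => ha _) (fun _ => hH _)
    obtain ⟨e, he⟩ : ∃ e, 2 * (k + 1) - 4 * ((k + 1 - 1) / 3) - (k + 1 - 1) % 3 = e + 2 :=
      ⟨2 * (k + 1) - 4 * ((k + 1 - 1) / 3) - (k + 1 - 1) % 3 - 2, by omega⟩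
    have he' : 2 * (k + 4) - 4 * ((k + 4 - 1) / 3) - (k + 4 - 1) % 3 = e + 4 := by omega
    rw [he, pow_add, mul_comm (2 ^ e), mul_assoc] at h
    rw [he', Fin.prod_univ_castSucc, Fin.prod_univ_castSucc, Fin.prod_univ_castSucc]
    convert HadamardOrder.product_four h (hH (Fin.last (k + 1)).castSucc.castSucc)
      (hH (Fin.last (k + 2)).castSucc) (hH (Fin.last (k + 3))) using 1
    ring
end
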